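/- Let s ≥ 1 and r ≥ 2 be integers with r ≤ s+1. Then for every integer n ≥ 2s+2, the Turán number of Berge matchings satisfies ex_r(n, BM_{s+1}) = max{ C(2s+1, r), C(s, r−1)·(n−s) + C(s, r) }. -/

import Mathlib

open Finset

/-- `H` is an `r`-uniform hypergraph (an `r`-graph): every hyperedge has exactly `r` vertices. -/
def IsUniform {V : Type*} (r : ℕ) (H : Finset (Finset V)) : Prop :=
  ∀ e ∈ H, e.card = r

/-- `H` contains a Berge copy of the graph with edge set `F`: there are an injection `g`
of the vertices of `F` into the vertices of `H` and an injection `φ` of the edges of `F`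
into the hyperedges of `H` such that `g '' e ⊆ φ e` for every edge `e` of `F`. -/
def ContainsBerge {α V : Type*} [DecidableEq α] [DecidableEq V]
    (F : Finset (Finset α)) (H : Finset (Finset V)) : Prop :=
  ∃ (g : α → V) (φ : Finset α → Finset V),
    Function.Injective g ∧ Set.InjOn φ ↑F ∧
      (∀ e ∈ F, φ e ∈ H) ∧ ∀ e ∈ F, e.image g ⊆ φ e

/-- `H` contains a copy (a subhypergraph isomorphic to) of the hypergraph with
vertex set `A` and edge set `F`. -/
def ContainsCopy {α V : Type*} [DecidableEq α] [DecidableEq V]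
    (A : Finset α) (F : Finset (Finset α)) (H : Finset (Finset V)) : Prop :=
  ∃ g : α → V, Set.InjOn g ↑A ∧ ∀ e ∈ F, e.image g ∈ H

/-- The edge set of the matching `M_t` consisting of `t` pairwise disjoint edges. -/
def matchingHG (t : ℕ) : Finset (Finset (Fin t × Fin 2)) :=
  Finset.univ.image fun i : Fin t => ({(i, 0), (i, 1)} : Finset (Fin t × Fin 2))

/-- The Turán number: the maximum number of hyperedges in an `r`-graph on `n` vertices
satisfying the freeness predicate `Free`. -/
noncomputable def exr (n r : ℕ) (Free : Finset (Finset (Fin n)) → Prop) : ℕ :=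
  sSup {m | ∃ H : Finset (Finset (Fin n)), IsUniform r H ∧ Free H ∧ H.card = m}

theorem containsBerge_matchingHG_iff {V : Type*} [DecidableEq V] {t : ℕ}
    {H : Finset (Finset V)} :
    ContainsBerge (matchingHG t) H ↔
      ∃ (g : Fin t × Fin 2 → V) (ψ : Fin t → Finset V), Function.Injective g ∧
        Function.Injective ψ ∧ (∀ i, ψ i ∈ H) ∧ ∀ i j, g (i, j) ∈ ψ i := by
  have hinj : Function.Injective
      fun i : Fin t => ({(i, 0), (i, 1)} : Finset (Fin t × Fin 2)) := by
    intro i j hij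
    have h : (i, (0 : Fin 2)) ∈ ({(j, 0), (j, 1)} : Finset (Fin t × Fin 2)) := by
      have hij' : ({(i, 0), (i, 1)} : Finset (Fin t × Fin 2)) = {(j, 0), (j, 1)} := hij
      rw [← hij']
      simp
    simpa using h
  constructor
  · rintro ⟨g, φ, hg, hφ, hH, hsub⟩
    have hmem (i : Fin t) :
        ({(i, 0), (i, 1)} : Finset (Fin t × Fin 2)) ∈ matchingHG t :=
      mem_image_of_mem _ (mem_univ i)
    refine ⟨g, fun i => φ {(i, 0), (i, 1)}, hg, fun i j hij => hinj (hφ (hmem i) (hmem j) hij),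
      fun i => hH _ (hmem i), fun i j => hsub _ (hmem i) (mem_image_of_mem _ ?_)⟩
    fin_cases j <;> simp
  · rintro ⟨g, ψ, hg, hψ, hH, hmem⟩
    refine ⟨g, Function.extend (fun i => {(i, 0), (i, 1)}) ψ fun _ => ∅, hg, ?_, ?_, ?_⟩
    · simp only [matchingHG, coe_image, coe_univ, Set.image_univ]
      rintro _ ⟨i, rfl⟩ _ ⟨j, rfl⟩ hij
      rw [hinj.extend_apply, hinj.extend_apply] at hij
      rw [hψ hij]
    · simp only [matchingHG, mem_image, mem_univ, true_and, forall_exists_index,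
        forall_apply_eq_imp_iff]
      intro i
      rw [hinj.extend_apply]
      exact hH i
    · simp only [matchingHG, mem_image, mem_univ, true_and, forall_exists_index,
        forall_apply_eq_imp_iff]
      intro i
      rw [hinj.extend_apply]
      simp [insert_subset_iff, hmem]

/-- Two copies of each hyperedge, adjacent to each other and to the vertices of the hyperedge,
together with a clique on `K` that is completely joined to the vertices. -/
def bergeGadget {V : Type*} (H : Finset (Finset V)) (K : Type*) :
    SimpleGraph (V ⊕ K ⊕ H × Bool) where
  Adj
    | .inl v, .inr (.inr p) => v ∈ p.1.1
    | .inr (.inr p), .inl v => v ∈ p.1.1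
    | .inl _, .inr (.inl _) => True
    | .inr (.inl _), .inl _ => True
    | .inr (.inl i), .inr (.inl j) => i ≠ j
    | .inr (.inr p), .inr (.inr q) => p.1 = q.1 ∧ p.2 ≠ q.2
    | _, _ => False
  symm := ⟨by
    rintro (v | i | p) (w | j | q) h <;> simp_all [eq_comm]⟩
  loopless := ⟨by
    rintro (v | i | p) <;> simp⟩

theorem containsBerge_of_isPerfectMatching_bergeGadget {V K : Type*} [Fintype V] [Fintype K]
    [DecidableEq V] {H : Finset (Finset V)} {t : ℕ}
    (hK : Fintype.card K + 2 * t ≤ Fintype.card V)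
    {M : (bergeGadget H K).Subgraph} (hM : M.IsPerfectMatching) :
    ContainsBerge (matchingHG t) H := by
  classical
  rw [SimpleGraph.Subgraph.isPerfectMatching_iff] at hM
  choose f hf hu using hM
  have hadj (w) : (bergeGadget H K).Adj w (f w) := (hf w).adj_sub
  have hff (w) : f (f w) = w := (hu _ _ (hf w).symm).symm
  have hfinj : Function.Injective f := Function.LeftInverse.injective hff
  set H' : Finset H := univ.filter fun h => ∀ b, ∃ v, f (.inr (.inr (h, b))) = .inl v with hH'
  have hcover (v : V) : (∃ k : K, f (.inl v) = .inr (.inl k)) ∨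
      ∃ p ∈ H' ×ˢ (univ : Finset Bool), f (.inl v) = .inr (.inr p) := by
    rcases hv : f (.inl v) with w | k | ⟨h, b⟩
    · have := hadj (.inl v)
      rw [hv] at this
      exact this.elim
    · exact .inl ⟨k, rfl⟩
    · refine .inr ⟨(h, b), ?_, rfl⟩
      have hb : f (.inr (.inr (h, b))) = .inl v := by rw [← hv, hff]
      simp only [hH', mem_product, mem_filter, mem_univ, true_and, and_true]
      intro b'
      by_cases hbb : b' = b
      · exact ⟨v, hbb ▸ hb⟩
      · have := hadj (.inr (.inr (h, b')))
        rcases hv' : f (.inr (.inr (h, b'))) with w | k | ⟨h', b''⟩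
        · exact ⟨w, rfl⟩
        · rw [hv'] at this
          exact this.elim
        · rw [hv'] at this
          obtain ⟨h1, h2⟩ := this
          simp only at h1 h2
          have : b'' = b := by
            revert hbb h2; cases b <;> cases b' <;> cases b'' <;> simp
          subst h1 this
          have := hff (.inr (.inr (h, b')))
          rw [hv', hb] at this
          cases this
  have hcard : Fintype.card V ≤ Fintype.card K + H'.card * 2 := by
    have hsub : (univ : Finset V).image (fun v => f (.inl v)) ⊆
        (univ : Finset K).image (fun k => .inr (.inl k)) ∪
          (H' ×ˢ (univ : Finset Bool)).image (fun p => .inr (.inr p)) := by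
      intro w hw
      obtain ⟨v, -, rfl⟩ := mem_image.1 hw
      rcases hcover v with ⟨k, hk⟩ | ⟨p, hp, hpv⟩
      · rw [hk]; simp
      · rw [hpv]; exact mem_union_right _ (mem_image_of_mem _ hp)
    have h1 := card_le_card hsub
    rw [card_image_of_injective _ fun v w h => Sum.inl_injective (hfinj h), card_univ] at h1
    refine h1.trans ((card_union_le _ _).trans (add_le_add card_image_le ?_))
    exact card_image_le.trans (by simp)
  obtain ⟨e⟩ : Nonempty (Fin t ↪ H') :=
    Function.Embedding.nonempty_of_card_le (by simp; omega)
  have hget (i : Fin t) (j : Fin 2) :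
      ∃ v, f (.inr (.inr ((e i).1, decide (j = 0)))) = .inl v :=
    (mem_filter.1 (e i).2).2 _
  choose g hg using hget
  refine containsBerge_matchingHG_iff.2 ⟨fun x => g x.1 x.2, fun i => (e i).1.1, ?_, ?_,
    fun i => (e i).1.2, ?_⟩
  · rintro ⟨i, j⟩ ⟨i', j'⟩ h
    have := hfinj ((hg i j).trans ((congrArg Sum.inl h).trans (hg i' j').symm))
    simp only [Sum.inr.injEq, Prod.mk.injEq, decide_eq_decide] at this
    obtain ⟨h1, h2⟩ := this
    have h3 := e.injective (Subtype.ext h1)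
    simp only [h3, Prod.mk.injEq, true_and]
    omega
  · intro i j h
    exact e.injective (Subtype.ext (Subtype.ext h))
  · intro i j
    have := hadj (.inr (.inr ((e i).1, decide (j = 0))))
    rw [hg] at this
    exact this

/-- Tutte's theorem, with the components of the graph with `S` removed given by the fibres of `c`
outside `S`, and with the parity gain for a graph of even order. -/
theorem exists_labelling_of_not_isPerfectMatching {W : Type*} [Fintype W] [DecidableEq W]
    {G : SimpleGraph W} (hG : ¬ ∃ M : G.Subgraph, M.IsPerfectMatching)
    (heven : Even (Fintype.card W)) :
    ∃ (S : Finset W) (c : W → Finset W),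
      (∀ u v, u ∉ S → v ∉ S → G.Adj u v → c u = c v) ∧
      (∀ P : W → Prop, (∀ u v, u ∉ S → v ∉ S → G.Adj u v → P u → P v) →
        ∀ u v, u ∉ S → v ∉ S → c u = c v → P u → P v) ∧
      S.card + 2 ≤ #{i ∈ Sᶜ.image c | Odd #{w ∈ Sᶜ | c w = i}} := by
  classical
  rw [SimpleGraph.tutte] at hG
  push Not at hG
  obtain ⟨u, hu⟩ := hG
  unfold SimpleGraph.IsTutteViolator at hu
  set G' := ((⊤ : G.Subgraph).deleteVerts u).coe with hG'
  set S := u.toFinset with hS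
  have hmem {w : W} : w ∈ ((⊤ : G.Subgraph).deleteVerts u).verts ↔ w ∉ S := by simp [hS]
  set c : W → Finset W := fun w => if h : w ∉ S then
    univ.filter fun x => ∃ hx : x ∉ S, G'.Reachable ⟨x, hmem.2 hx⟩ ⟨w, hmem.2 h⟩ else ∅ with hc
  have hceq {x w : W} (hx : x ∉ S) (hw : w ∉ S) :
      c x = c w ↔ G'.Reachable ⟨x, hmem.2 hx⟩ ⟨w, hmem.2 hw⟩ := by
    simp only [hc, hx, hw, not_false_eq_true, dif_pos]
    constructor
    · intro h
      have : x ∈ univ.filter fun y => ∃ hy : y ∉ S,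
          G'.Reachable ⟨y, hmem.2 hy⟩ ⟨w, hmem.2 hw⟩ := by
        rw [← h]; simp [hx]
      simp only [mem_filter] at this
      exact this.2.2
    · intro h
      ext y
      simp only [mem_filter, mem_univ, true_and]
      exact exists_congr fun hy => ⟨fun h' => h'.trans h, fun h' => h'.trans h.symm⟩
  have hadj {x w : W} (hx : x ∉ S) (hw : w ∉ S) :
      G'.Adj ⟨x, hmem.2 hx⟩ ⟨w, hmem.2 hw⟩ ↔ G.Adj x w := by
    have hx' : x ∉ u := by simpa [hS] using hx
    have hw' : w ∉ u := by simpa [hS] using hw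
    simp [hG', hx', hw']
  refine ⟨S, c, fun x w hx hw h => (hceq hx hw).2 ((hadj hx hw).2 h).reachable, ?_, ?_⟩
  · intro P hP x w hx hw h hPx
    obtain ⟨p⟩ := (hceq hx hw).1 h
    have key : ∀ a b : ((⊤ : G.Subgraph).deleteVerts u).verts, G'.Walk a b → P a.1 → P b.1 := by
      intro a b p
      induction p with
      | nil => exact id
      | @cons a b d hab _ ih =>
        exact fun ha => ih (hP a.1 b.1 (hmem.1 a.2) (hmem.1 b.2)
          ((hadj (hmem.1 a.2) (hmem.1 b.2)).1 hab) ha)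
    exact key _ _ p hPx
  · have hcard : Nat.card ((⊤ : G.Subgraph).deleteVerts u).verts + S.card = Fintype.card W := by
      have : ((⊤ : G.Subgraph).deleteVerts u).verts = ((Sᶜ : Finset W) : Set W) := by
        ext w; simp [hS]
      rw [this, Nat.card_coe_set_eq, Set.ncard_coe_finset, card_compl_add_card]
    have huS : u.ncard = S.card := by rw [hS, Set.ncard_eq_toFinset_card']
    have hpar : Odd G'.oddComponents.ncard ↔ Odd S.card := by
      rw [SimpleGraph.odd_ncard_oddComponents]
      rw [← hcard, Nat.even_add'] at heven
      exact heven
    have hle : S.card + 2 ≤ G'.oddComponents.ncard := by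
      rw [huS] at hu
      grind
    refine hle.trans ?_
    have hfib (x : W) (hx : x ∉ S) :
        (G'.connectedComponentMk ⟨x, hmem.2 hx⟩).supp.ncard = #{w ∈ Sᶜ | c w = c x} := by
      rw [← Set.ncard_image_of_injective _ Subtype.val_injective, ← Set.ncard_coe_finset]
      congr 1
      ext w
      simp only [Set.mem_image, SimpleGraph.ConnectedComponent.mem_supp_iff,
        SimpleGraph.ConnectedComponent.eq, coe_filter, mem_compl, Set.mem_ofPred_eq]
      constructor
      · rintro ⟨⟨a, ha⟩, h, rfl⟩
        exact ⟨hmem.1 ha, (hceq (hmem.1 ha) hx).2 h⟩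
      · rintro ⟨hw, h⟩
        exact ⟨⟨w, hmem.2 hw⟩, (hceq hw hx).1 h, rfl⟩
    rw [← Set.ncard_coe_finset]
    refine Set.ncard_le_ncard_of_injOn (fun C => c C.out.1) ?_ ?_ (Set.toFinite _)
    · intro C hC
      have hx := hmem.1 C.out.2
      have hC' : G'.connectedComponentMk C.out = C := Quot.out_eq C
      simp only [coe_filter, mem_image, Set.mem_ofPred_eq]
      refine ⟨⟨_, mem_compl.2 hx, rfl⟩, ?_⟩
      rw [← hfib _ hx]
      change Odd (G'.connectedComponentMk C.out).supp.ncard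
      rw [hC']
      exact hC
    · intro C _ D _ h
      have := (hceq (hmem.1 C.out.2) (hmem.1 D.out.2)).1 h
      rw [← show G'.connectedComponentMk C.out = C from Quot.out_eq C,
        ← show G'.connectedComponentMk D.out = D from Quot.out_eq D]
      exact SimpleGraph.ConnectedComponent.eq.2 this

/-- If `H` has no Berge matching of size `t`, then after removing a set `A` of vertices and a set
`D` of hyperedges, many classes remain such that no remaining hyperedge meets two of them. -/
theorem exists_labelling_of_not_containsBerge.{u} {V : Type u} [Fintype V] [DecidableEq V]
    {H : Finset (Finset V)} {t : ℕ} (ht : 2 * t ≤ Fintype.card V)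
    (hH : ¬ ContainsBerge (matchingHG t) H) :
    ∃ (ι : Type u) (_ : DecidableEq ι) (A : Finset V) (D : Finset (Finset V)) (c : V → ι),
      (∀ h ∈ H, h ∉ D → ∀ v ∈ h, ∀ w ∈ h, v ∉ A → w ∉ A → c v = c w) ∧
      Fintype.card V + #A + 2 * #D + 2 ≤ #(Aᶜ.image c) + 2 * t := by
  classical
  set k := Fintype.card V - 2 * t with hk
  have hcardW : Even (Fintype.card (V ⊕ Fin k ⊕ H × Bool)) := by
    simp only [Fintype.card_sum, Fintype.card_fin, Fintype.card_prod, Fintype.card_bool]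
    rw [Nat.even_iff]
    omega
  obtain ⟨S, c, hadj, hconn, hS⟩ := exists_labelling_of_not_isPerfectMatching
    (G := bergeGadget H (Fin k))
    (fun ⟨M, hM⟩ => hH (containsBerge_of_isPerfectMatching_bergeGadget (by simp; omega) hM))
    hcardW
  set A : Finset V := univ.filter fun v => .inl v ∈ S with hA
  set T : Finset (Fin k) := univ.filter fun i => .inr (.inl i) ∈ S with hT
  set D : Finset H := univ.filter fun h => ∀ b, .inr (.inr (h, b)) ∈ S with hD
  set E : Finset (H × Bool) :=
    univ.filter fun p => .inr (.inr p) ∉ S ∧ .inr (.inr (p.1, !p.2)) ∈ S with hE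
  have hSle : #A + #T + 2 * #D + #E ≤ #S := by
    have h1 : #(D ×ˢ (univ : Finset Bool) ∪ E.image fun p => (p.1, !p.2)) = 2 * #D + #E := by
      rw [card_union_of_disjoint, card_product, card_image_of_injective, card_univ,
        Fintype.card_bool, mul_comm]
      · rintro ⟨h, b⟩ ⟨h', b'⟩ hh
        simpa using hh
      · rw [disjoint_left]
        rintro ⟨h, b⟩ hp hp'
        simp only [hD, mem_product, mem_filter, mem_univ, true_and, and_true] at hp
        simp only [hE, mem_image, mem_filter, mem_univ, true_and, Prod.mk.injEq] at hp'
        obtain ⟨⟨h', b'⟩, h1, rfl, h2⟩ := hp'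
        exact h1.1 (hp b')
    rw [add_assoc, ← h1, add_assoc, ← card_disjSum, ← card_disjSum]
    refine card_le_card fun w hw => ?_
    rcases w with v | i | p
    · simpa [hA] using hw
    · simpa [hT] using hw
    · simp only [inr_mem_disjSum, mem_union, mem_product, mem_univ, and_true, mem_image] at hw
      rcases hw with hw | ⟨q, hq, rfl⟩
      · exact (mem_filter.1 hw).2 p.2
      · exact (mem_filter.1 hq).2.2
  set O := {i ∈ Sᶜ.image c | Odd #{w ∈ Sᶜ | c w = i}} with hO
  have hOsub : ∀ i ∈ O, i ∈ E.image (fun p => c (.inr (.inr p))) ∨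
      (∃ v, .inl v ∉ S ∧ c (.inl v) = i) ∨ ∃ j, .inr (.inl j) ∉ S ∧ c (.inr (.inl j)) = i := by
    intro i hi
    by_contra! hcon
    obtain ⟨hiE, hiV, hiK⟩ := hcon
    simp only [hO, mem_filter, mem_image, mem_compl] at hi
    obtain ⟨⟨w, hw, hwi⟩, hodd⟩ := hi
    rcases w with v | j | ⟨h, b⟩
    · exact hiV v hw hwi
    · exact hiK j hw hwi
    have hb : .inr (.inr (h, !b)) ∉ S := fun hb =>
      hiE (mem_image.2 ⟨(h, b), by simp [hE, hw, hb], hwi⟩)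
    have hcb : c (.inr (.inr (h, !b))) = i := by
      rw [← hwi]
      exact hadj _ _ hb hw ⟨rfl, by simp⟩
    have hfib : {w ∈ Sᶜ | c w = i} =
        ({.inr (.inr (h, b)), .inr (.inr (h, !b))} : Finset (V ⊕ Fin k ⊕ H × Bool)) := by
      ext w
      simp only [mem_filter, mem_compl, mem_insert, mem_singleton]
      constructor
      · rintro ⟨hwS, hwc⟩
        have := hconn (fun u => c u = i ∧ (u = .inr (.inr (h, b)) ∨ u = .inr (.inr (h, !b))))
          ?_ _ w hw hwS (hwi.trans hwc.symm) ⟨hwi, .inl rfl⟩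
        · exact this.2
        · rintro x y hx hy hxy ⟨hcx, hx'⟩
          have hcy : c y = i := (hadj x y hx hy hxy).symm.trans hcx
          refine ⟨hcy, ?_⟩
          rcases y with v | j | ⟨h', b'⟩
          · exact (hiV v hy hcy).elim
          · exact (hiK j hy hcy).elim
          · have hh' : h' = h := by
              rcases hx' with rfl | rfl <;> exact hxy.1.symm
            have hb' : b' = b ∨ b' = !b := by
              cases b <;> cases b' <;> decide
            rcases hb' with rfl | rfl
            · exact .inl (hh' ▸ rfl)
            · exact .inr (hh' ▸ rfl)
      · rintro (rfl | rfl)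
        · exact ⟨hw, hwi⟩
        · exact ⟨hb, hcb⟩
    rw [hfib, card_pair (by simp)] at hodd
    exact absurd hodd (by decide)
  have hKS : ∀ j, .inr (.inl j) ∈ S := by
    by_contra! hcon
    obtain ⟨j, hj⟩ := hcon
    have : O ⊆ insert (c (.inr (.inl j))) (E.image fun p => c (.inr (.inr p))) := by
      intro i hi
      rw [mem_insert]
      rcases hOsub i hi with hi | ⟨v, hv, rfl⟩ | ⟨j', hj', rfl⟩
      · exact .inr hi
      · exact .inl (hadj _ _ hv hj trivial)
      · by_cases hjj : j' = j
        · exact .inl (hjj ▸ rfl)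
        · exact .inl (hadj _ _ hj' hj hjj)
    have h1 := (card_le_card this).trans (card_insert_le _ _)
    have h2 := card_image_le (s := E) (f := fun p => c (.inr (.inr p)))
    omega
  have hTk : #T = k := by simp [hT, hKS]
  have hOle : #O ≤ #E + #(Aᶜ.image fun v => c (.inl v)) := by
    have : O ⊆ E.image (fun p => c (.inr (.inr p))) ∪ Aᶜ.image fun v => c (.inl v) := by
      intro i hi
      rw [mem_union]
      rcases hOsub i hi with hi | ⟨v, hv, rfl⟩ | ⟨j, hj, rfl⟩
      · exact .inl hi
      · exact .inr (mem_image.2 ⟨v, by simp [hA, hv], rfl⟩)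
      · exact (hj (hKS j)).elim
    exact (card_le_card this).trans ((card_union_le _ _).trans (by gcongr; exact card_image_le))
  refine ⟨_, inferInstance, A, D.image Subtype.val, fun v => c (.inl v), ?_, ?_⟩
  · intro h hh hhD v hv w hw hvA hwA
    have hD' : (⟨h, hh⟩ : H) ∉ D := fun h' => hhD (mem_image.2 ⟨_, h', rfl⟩)
    simp only [hD, mem_filter, mem_univ, true_and, not_forall] at hD'
    obtain ⟨b, hb⟩ := hD'
    simp only [hA, mem_filter, mem_univ, true_and] at hvA hwA
    exact (hadj (.inl v) _ hvA hb hv).trans (hadj (.inl w) _ hwA hb hw).symm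
  · rw [card_image_of_injective _ Subtype.val_injective]
    omega

theorem choose_add_choose_le_choose_add (b x y k : ℕ) :
    (b + x).choose k + (b + y).choose k ≤ (b + x + y).choose k + b.choose k := by
  cases k with
  | zero => simp
  | succ k =>
    induction y with
    | zero => simp
    | succ y ih =>
      rw [← add_assoc b, ← add_assoc (b + x), Nat.choose_succ_succ',
        Nat.choose_succ_succ' (b + x + y)]
      have := Nat.choose_le_choose k (show b + y ≤ b + x + y by omega)
      omega

theorem sum_choose_sub_choose_le {ι : Type*} (Q : Finset ι) (f : ι → ℕ) (hf : ∀ i ∈ Q, 1 ≤ f i)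
    (a k : ℕ) :
    ∑ i ∈ Q, ((a + f i).choose (k + 1) - a.choose (k + 1)) + (a + 1).choose (k + 1) ≤
      #Q * a.choose k + (a + 1 + ∑ i ∈ Q, (f i - 1)).choose (k + 1) := by
  classical
  induction Q using Finset.induction_on with
  | empty => simp
  | insert i Q hi ih =>
    rw [sum_insert hi, sum_insert hi, card_insert_of_notMem hi]
    have ih' := ih fun j hj => hf j (mem_insert_of_mem hj)
    have hfi := hf i (mem_insert_self _ _)
    have h := choose_add_choose_le_choose_add (a + 1) (∑ j ∈ Q, (f j - 1)) (f i - 1) (k + 1)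
    rw [show a + 1 + (f i - 1) = a + f i by omega] at h
    rw [add_comm (f i - 1), ← add_assoc (a + 1), add_mul]
    rw [Nat.choose_succ_succ' a k] at *
    have hmono := Nat.choose_le_choose (k + 1) (show a ≤ a + f i by omega)
    omega

theorem card_le_of_labelling {V ι : Type*} [Fintype V] [DecidableEq V] [DecidableEq ι]
    {k : ℕ} {F : Finset (Finset V)} (hF : IsUniform (k + 1) F) {A : Finset V} {c : V → ι}
    (hc : ∀ h ∈ F, ∀ v ∈ h, ∀ w ∈ h, v ∉ A → w ∉ A → c v = c w) (hA : (Aᶜ.image c).Nonempty) :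
    #F ≤ (#(Aᶜ.image c) - 1) * (#A).choose k +
      (Fintype.card V + 1 - #(Aᶜ.image c)).choose (k + 1) := by
  set Q := Aᶜ.image c with hQ
  set C : ι → Finset V := fun i => {v ∈ Aᶜ | c v = i} with hC
  have hdisj (i : ι) : Disjoint A (C i) := by
    rw [disjoint_left]
    intro v hv hv'
    exact mem_compl.1 (mem_filter.1 hv').1 hv
  have hCpos : ∀ i ∈ Q, 1 ≤ #(C i) := by
    intro i hi
    obtain ⟨v, hv, rfl⟩ := mem_image.1 hi
    exact card_pos.2 ⟨v, mem_filter.2 ⟨hv, rfl⟩⟩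
  have hsub : F ⊆ powersetCard (k + 1) A ∪
      Q.biUnion fun i => powersetCard (k + 1) (A ∪ C i) \ powersetCard (k + 1) A := by
    intro h hh
    by_cases hhA : h ⊆ A
    · exact mem_union_left _ (mem_powersetCard.2 ⟨hhA, hF h hh⟩)
    · obtain ⟨v, hv, hvA⟩ := not_subset.1 hhA
      refine mem_union_right _ (mem_biUnion.2
        ⟨c v, mem_image_of_mem _ (mem_compl.2 hvA), mem_sdiff.2 ⟨mem_powersetCard.2
          ⟨fun w hw => ?_, hF h hh⟩, fun h' => hhA (mem_powersetCard.1 h').1⟩⟩)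
      by_cases hwA : w ∈ A
      · exact mem_union_left _ hwA
      · exact mem_union_right _ (mem_filter.2
          ⟨mem_compl.2 hwA, hc h hh w hw v hv hwA hvA⟩)
  have h1 : #F ≤ (#A).choose (k + 1) +
      ∑ i ∈ Q, ((#A + #(C i)).choose (k + 1) - (#A).choose (k + 1)) := by
    refine (card_le_card hsub).trans ((card_union_le _ _).trans
      (add_le_add (card_powersetCard _ _).le (card_biUnion_le.trans (sum_le_sum fun i _ => ?_))))
    rw [card_sdiff_of_subset (powersetCard_mono subset_union_left), card_powersetCard,
      card_powersetCard, card_union_of_disjoint (hdisj i)]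
  have h2 := sum_choose_sub_choose_le Q (fun i => #(C i)) hCpos (#A) k
  have h3 : ∑ i ∈ Q, (#(C i) - 1) + #Q + #A = Fintype.card V := by
    rw [← card_compl_add_card A, card_eq_sum_card_image c Aᶜ, card_eq_sum_ones Q,
      ← sum_add_distrib]
    congr 1
    exact sum_congr rfl fun i hi => Nat.sub_add_cancel (hCpos i hi)
  rw [show Fintype.card V + 1 - #Q = #A + 1 + ∑ i ∈ Q, (#(C i) - 1) by omega]
  obtain ⟨q, hq⟩ : ∃ q, #Q = q + 1 := ⟨#Q - 1, by have := card_pos.2 hA; omega⟩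
  rw [hq, Nat.add_sub_cancel]
  rw [hq, add_mul, Nat.choose_succ_succ'] at h2
  omega

theorem self_le_choose {m j : ℕ} (hj : 1 ≤ j) (hjm : j < m) : m ≤ m.choose j := by
  induction m generalizing j with
  | zero => omega
  | succ m ih =>
    obtain ⟨j, rfl⟩ := Nat.exists_eq_add_one_of_ne_zero (by omega : j ≠ 0)
    rcases Nat.eq_zero_or_pos j with rfl | hj0
    · simp
    · rw [Nat.choose_succ_succ']
      have h1 := ih hj0 (by omega)
      have h2 := Nat.choose_pos (show j + 1 ≤ m by omega)
      omega

theorem le_max_of_increments {h : ℕ → ℕ} {s : ℕ}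
    (hstep : ∀ i j, i ≤ j → j < s → h i ≤ h (i + 1) → h j ≤ h (j + 1)) {a : ℕ} (ha : a ≤ s) :
    h a ≤ max (h 0) (h s) := by
  rcases ha.eq_or_lt with rfl | ha'
  · exact le_max_right _ _
  by_cases hup : h a ≤ h (a + 1)
  · refine le_max_of_le_right ?_
    have : ∀ j, a + j ≤ s → h a ≤ h (a + j) := by
      intro j
      induction j with
      | zero => simp
      | succ j ih =>
        exact fun hj => (ih (by omega)).trans (hstep a _ (by omega) (by omega) hup)
    simpa [Nat.add_sub_cancel' ha] using this (s - a) (by omega)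
  · refine le_max_of_le_left ?_
    have : ∀ j, j ≤ a → h j ≤ h 0 := by
      intro j
      induction j with
      | zero => simp
      | succ j ih =>
        refine fun hj => le_trans ?_ (ih (by omega))
        by_contra! hlt
        exact hup (hstep j a (by omega) ha' hlt.le)
    exact this a le_rfl

theorem add_choose_add_mul_choose_le_max {s k n a x d : ℕ} (hk : 1 ≤ k) (hks : k ≤ s)
    (hn : 2 * s + 2 ≤ n) (hx : 2 * a + x + 2 * d ≤ 2 * s) :
    d + ((a + 1 + x).choose (k + 1) + (n - a - x - 1) * a.choose k) ≤
      max ((2 * s + 1).choose (k + 1)) (s.choose k * (n - s) + s.choose (k + 1)) := by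
  rcases lt_or_ge (a + 1 + x) k with hlt | hge
  · rw [Nat.choose_eq_zero_of_lt (show a + 1 + x < k + 1 by omega),
      Nat.choose_eq_zero_of_lt (show a < k by omega)]
    have := self_le_choose (show 1 ≤ k + 1 by omega) (show k + 1 < 2 * s + 1 by omega)
    exact le_max_of_le_left (by omega)
  have hgrow : ∀ j, a + x + j + 1 ≤ n →
      j + ((a + 1 + x).choose (k + 1) + (n - a - x - 1) * a.choose k) ≤
        (a + 1 + (x + j)).choose (k + 1) + (n - a - (x + j) - 1) * a.choose k := by
    intro j
    induction j with
    | zero => simp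
    | succ j ih =>
      intro hj
      have ih' := ih (by omega)
      obtain ⟨N, hN⟩ : ∃ N, n - a - (x + j) - 1 = N + 1 := ⟨n - a - (x + j) - 2, by omega⟩
      rw [hN, add_mul, one_mul] at ih'
      rw [show n - a - (x + (j + 1)) - 1 = N by omega,
        show a + 1 + (x + (j + 1)) = (a + 1 + (x + j)) + 1 by omega, Nat.choose_succ_succ']
      have hlt : a.choose k + 1 ≤ (a + 1 + (x + j)).choose k := by
        rcases lt_or_ge a k with h | h
        · rw [Nat.choose_eq_zero_of_lt h]
          exact Nat.choose_pos (by omega)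
        · refine le_trans ?_ (Nat.choose_le_choose k (show a + 1 ≤ _ by omega))
          obtain ⟨k, rfl⟩ := Nat.exists_eq_add_one_of_ne_zero (by omega : k ≠ 0)
          rw [Nat.choose_succ_succ']
          have := Nat.choose_pos (show k ≤ a by omega)
          omega
      omega
  obtain ⟨N, rfl⟩ : ∃ N, n = N + (2 * s + 1) := ⟨n - (2 * s + 1), by omega⟩
  set h : ℕ → ℕ := fun a => (2 * s + 1 - a).choose (k + 1) + (N + a) * a.choose k with hh
  have h1 := hgrow (2 * s - 2 * a - x) (by omega)
  rw [show a + 1 + (x + (2 * s - 2 * a - x)) = 2 * s + 1 - a by omega,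
    show N + (2 * s + 1) - a - (x + (2 * s - 2 * a - x)) - 1 = N + a by omega] at h1
  have h2 : h a ≤ max (h 0) (h s) := by
    refine le_max_of_increments ?_ (by omega)
    have hiff (i : ℕ) (hi : i < s) : h i ≤ h (i + 1) ↔
        (2 * s - i).choose k ≤ (N + i + 1) * i.choose (k - 1) + i.choose k := by
      obtain ⟨k, rfl⟩ := Nat.exists_eq_add_one_of_ne_zero (by omega : k ≠ 0)
      simp only [hh]
      have h1 : (N + (i + 1)) * (i.choose k + i.choose (k + 1)) =
          (N + i + 1) * i.choose k + ((N + i) * i.choose (k + 1) + i.choose (k + 1)) := by ring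
      rw [show 2 * s + 1 - i = (2 * s - i) + 1 by omega,
        show 2 * s + 1 - (i + 1) = 2 * s - i by omega, Nat.choose_succ_succ' (2 * s - i),
        Nat.choose_succ_succ' i, h1, Nat.succ_sub_one]
      omega
    intro i j hij hj hi
    rw [hiff i (by omega)] at hi
    rw [hiff j hj]
    calc _ ≤ (2 * s - i).choose k := Nat.choose_le_choose _ (by omega)
      _ ≤ _ := hi
      _ ≤ _ := by
        gcongr
  have h3 : h 0 = (2 * s + 1).choose (k + 1) := by
    simp [hh, Nat.choose_eq_zero_of_lt (show 0 < k by omega)]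
  have h4 : h s = s.choose k * (N + (2 * s + 1) - s) + s.choose (k + 1) := by
    simp only [hh]
    rw [show 2 * s + 1 - s = s + 1 by omega, Nat.choose_succ_succ',
      show N + (2 * s + 1) - s = N + s + 1 by omega]
    ring
  rw [← h3, ← h4]
  refine le_trans ?_ h2
  simp only [hh]
  omega

theorem card_le_of_not_containsBerge {s k n : ℕ} (hk : 1 ≤ k) (hks : k ≤ s)
    (hn : 2 * s + 2 ≤ n) {H : Finset (Finset (Fin n))} (hU : IsUniform (k + 1) H)
    (hH : ¬ ContainsBerge (matchingHG (s + 1)) H) :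
    #H ≤ max ((2 * s + 1).choose (k + 1)) (s.choose k * (n - s) + s.choose (k + 1)) := by
  obtain ⟨ι, _, A, D, c, hc, hcard⟩ :=
    exists_labelling_of_not_containsBerge (by simp; omega) hH
  rw [Fintype.card_fin] at hcard
  have hF := card_le_of_labelling (F := H \ D) (A := A) (c := c) (k := k)
    (fun h hh => hU h (mem_sdiff.1 hh).1)
    (fun h hh => hc h (mem_sdiff.1 hh).1 (mem_sdiff.1 hh).2)
    (card_pos.1 (by omega))
  rw [Fintype.card_fin] at hF
  have hD : #H ≤ #D + #(H \ D) := by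
    have := le_card_sdiff D H
    omega
  have hQ : #(Aᶜ.image c) + #A ≤ n := by
    have h1 := card_image_le (s := Aᶜ) (f := c)
    have h2 := card_compl_add_card A
    rw [Fintype.card_fin] at h2
    omega
  have := add_choose_add_mul_choose_le_max (a := #A) (x := n - #A - #(Aᶜ.image c)) (d := #D)
    hk hks hn (by omega)
  rw [show #A + 1 + (n - #A - #(Aᶜ.image c)) = n + 1 - #(Aᶜ.image c) by omega,
    show n - #A - (n - #A - #(Aᶜ.image c)) - 1 = #(Aᶜ.image c) - 1 by omega] at this
  omega

theorem not_containsBerge_powersetCard {V : Type*} [DecidableEq V] {s r : ℕ} {U : Finset V}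
    (hU : #U ≤ 2 * s + 1) : ¬ ContainsBerge (matchingHG (s + 1)) (powersetCard r U) := by
  rw [containsBerge_matchingHG_iff]
  rintro ⟨g, ψ, hg, -, hψ, hmem⟩
  have := card_le_card_of_injOn (s := univ) (t := U) g
    (fun x _ => (mem_powersetCard.1 (hψ x.1)).1 (hmem x.1 x.2)) hg.injOn
  simp at this
  omega

theorem not_containsBerge_of_card_sdiff_le_one {V : Type*} [DecidableEq V] {s : ℕ}
    {B : Finset V} (hB : #B ≤ s) {H : Finset (Finset V)} (hH : ∀ h ∈ H, #(h \ B) ≤ 1) :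
    ¬ ContainsBerge (matchingHG (s + 1)) H := by
  rw [containsBerge_matchingHG_iff]
  rintro ⟨g, ψ, hg, -, hψ, hmem⟩
  have hex (i : Fin (s + 1)) : ∃ j, g (i, j) ∈ B := by
    by_contra! hcon
    have := card_le_one.1 (hH _ (hψ i)) (g (i, 0)) (mem_sdiff.2 ⟨hmem i 0, hcon 0⟩)
      (g (i, 1)) (mem_sdiff.2 ⟨hmem i 1, hcon 1⟩)
    simpa using hg this
  choose j hj using hex
  have := card_le_card_of_injOn (s := univ) (t := B) (fun i => g (i, j i))
    (fun i _ => hj i) (fun a _ b _ hab => (Prod.ext_iff.1 (hg hab)).1)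
  simp at this
  omega

theorem card_filter_card_sdiff_le_one {V : Type*} [Fintype V] [DecidableEq V] (B : Finset V)
    (k : ℕ) :
    #{h ∈ powersetCard (k + 1) (univ : Finset V) | #(h \ B) ≤ 1} =
      (#B).choose k * (Fintype.card V - #B) + (#B).choose (k + 1) := by
  have hsplit : {h ∈ powersetCard (k + 1) (univ : Finset V) | #(h \ B) ≤ 1} =
      (powersetCard k B ×ˢ Bᶜ).image (fun p => insert p.2 p.1) ∪ powersetCard (k + 1) B := by
    ext h
    simp only [mem_filter, mem_powersetCard, subset_univ, true_and, mem_union, mem_image,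
      mem_product, mem_compl, Prod.exists]
    constructor
    · rintro ⟨hcard, hle⟩
      rcases Nat.le_one_iff_eq_zero_or_eq_one.1 hle with h0 | h1
      · exact .inr ⟨sdiff_eq_empty_iff_subset.1 (card_eq_zero.1 h0), hcard⟩
      · obtain ⟨v, hv⟩ := card_eq_one.1 h1
        have hvm : v ∈ h \ B := by rw [hv]; exact mem_singleton_self v
        rw [mem_sdiff] at hvm
        refine .inl ⟨h.erase v, v, ⟨⟨fun w hw => ?_, ?_⟩, hvm.2⟩, insert_erase hvm.1⟩
        · by_contra hwB
          have : w ∈ h \ B := mem_sdiff.2 ⟨mem_of_mem_erase hw, hwB⟩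
          rw [hv, mem_singleton] at this
          exact ne_of_mem_erase hw this
        · rw [card_erase_of_mem hvm.1, hcard, Nat.add_sub_cancel]
    · rintro (⟨e, v, ⟨⟨heB, hek⟩, hv⟩, rfl⟩ | ⟨hB, hk⟩)
      · refine ⟨by rw [card_insert_of_notMem fun h => hv (heB h), hek], ?_⟩
        rw [insert_sdiff_of_notMem _ hv, sdiff_eq_empty_iff_subset.2 heB]
        simp
      · exact ⟨hk, by simp [sdiff_eq_empty_iff_subset.2 hB]⟩
  rw [hsplit, card_union_of_disjoint, card_image_of_injOn, card_product, card_powersetCard,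
    card_powersetCard, card_compl]
  · rintro ⟨e, v⟩ hp ⟨e', v'⟩ hp' h
    simp only [coe_product, Set.mem_prod, mem_coe, mem_powersetCard, mem_compl] at hp hp'
    have he : e = e' := by
      have := congrArg (· ∩ B) h
      simpa [insert_inter_of_notMem hp.2, insert_inter_of_notMem hp'.2,
        inter_eq_left.2 hp.1.1, inter_eq_left.2 hp'.1.1] using this
    have hv : v ∈ insert v' e' := by
      rw [← show insert v e = insert v' e' from h]; exact mem_insert_self _ _
    subst he
    rw [mem_insert] at hv
    rcases hv with rfl | hv
    · rfl
    · exact (hp.2 (hp.1.1 hv)).elim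
  · rw [disjoint_left]
    intro h h1 h2
    obtain ⟨⟨e, v⟩, hp, rfl⟩ := mem_image.1 h1
    exact mem_compl.1 (mem_product.1 hp).2 ((mem_powersetCard.1 h2).1 (mem_insert_self _ _))

/-- Theorem: for `s ≥ 1`, `2 ≤ r ≤ s+1` and every `n ≥ 2s+2`,
`ex_r(n, BM_{s+1}) = max { C(2s+1, r), C(s, r-1)(n-s) + C(s, r) }`. -/
theorem exr_berge_matching_r_le_s_add_one
    (s r : ℕ) (hs : 1 ≤ s) (hr : 2 ≤ r) (hrs : r ≤ s + 1)
    (n : ℕ) (hn : 2 * s + 2 ≤ n) :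
    exr n r (fun H => ¬ ContainsBerge (matchingHG (s + 1)) H) =
      max (Nat.choose (2 * s + 1) r)
        (Nat.choose s (r - 1) * (n - s) + Nat.choose s r) := by
  obtain ⟨k, rfl⟩ : ∃ k, r = k + 1 := ⟨r - 1, by omega⟩
  rw [Nat.add_sub_cancel]
  have hub : ∀ m ∈ {m | ∃ H : Finset (Finset (Fin n)), IsUniform (k + 1) H ∧
      ¬ ContainsBerge (matchingHG (s + 1)) H ∧ #H = m},
      m ≤ max ((2 * s + 1).choose (k + 1)) (s.choose k * (n - s) + s.choose (k + 1)) := by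
    rintro _ ⟨H, hU, hH, rfl⟩
    exact card_le_of_not_containsBerge (by omega) (by omega) hn hU hH
  refine le_antisymm (csSup_le' hub) (max_le ?_ ?_)
  · obtain ⟨U, -, hU⟩ := exists_subset_card_eq (s := (univ : Finset (Fin n)))
      (show 2 * s + 1 ≤ _ by simp; omega)
    exact le_csSup ⟨_, hub⟩ ⟨powersetCard (k + 1) U, fun e he => (mem_powersetCard.1 he).2,
      not_containsBerge_powersetCard hU.le, by rw [card_powersetCard, hU]⟩
  · obtain ⟨B, -, hB⟩ := exists_subset_card_eq (s := (univ : Finset (Fin n)))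
      (show s ≤ _ by simp; omega)
    refine le_csSup ⟨_, hub⟩ ⟨{h ∈ powersetCard (k + 1) (univ : Finset (Fin n)) | #(h \ B) ≤ 1},
      fun e he => (mem_powersetCard.1 (mem_filter.1 he).1).2,
      not_containsBerge_of_card_sdiff_le_one hB.le fun h hh => (mem_filter.1 hh).2, ?_⟩
    rw [card_filter_card_sdiff_le_one, hB, Fintype.card_fin]
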